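/- arXiv:1607.07871 — 6 statements merged into one kernel-verified Lean document; each statement's English description precedes it below -/
import Mathlib

section
/- Lemma 1: Let p be an ontic extension satisfying both No Retrocausality and Time Symmetry (time-reversed No Retrocausality). Then: (i) measurement independence holds, i.e. the marginal ∑_{a∈A,b∈B} p(a,b,λ|x,y) takes the same value for all (x,y) ∈ X×Y; (ii) parameter independence for the preparation holds, i.e. for all a, λ, x the marginal ∑_{b∈B} p(a,b,λ|x,y) takes the same value for all y ∈ Y; (iii) parameter independence for the measurement holds, i.e. for all b, λ, y the marginal ∑_{a∈A} p(a,b,λ|x,y) takes the same value for all x ∈ X. -/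
/-- **Lemma 1.** If an ontic extension `p` satisfies No Retrocausality and Time Symmetry
(time-reversed No Retrocausality), then measurement independence and both parameter
independence conditions hold. -/
theorem lemma_one
    (X Y A B Λ : Type) [Fintype X] [Fintype Y] [Fintype A] [Fintype B] [Fintype Λ]
    [Nonempty X] [Nonempty Y] [Nonempty A] [Nonempty B]
    (p : A → B → Λ → X → Y → ℝ)
    (hp_nonneg : ∀ a b lam x y, 0 ≤ p a b lam x y)
    (hp_norm : ∀ x y, ∑ a, ∑ b, ∑ lam, p a b lam x y = 1)
    -- No Retrocausality
    (hNR : ∃ (f : B → A → Λ → X → Y → ℝ) (g : Λ → A → X → ℝ) (h : A → X → ℝ),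
      (∀ b a lam x y, 0 ≤ f b a lam x y) ∧ (∀ lam a x, 0 ≤ g lam a x) ∧
      (∀ a x, 0 ≤ h a x) ∧
      (∀ a lam x y, ∑ b, f b a lam x y = 1) ∧
      (∀ a x, ∑ lam, g lam a x = 1) ∧
      (∀ x, ∑ a, h a x = 1) ∧
      (∀ a b lam x y, p a b lam x y = f b a lam x y * g lam a x * h a x))
    -- Time Symmetry (time-reversed No Retrocausality)
    (hTS : ∃ (f' : A → B → Λ → X → Y → ℝ) (g' : Λ → B → Y → ℝ) (h' : B → Y → ℝ),
      (∀ a b lam x y, 0 ≤ f' a b lam x y) ∧ (∀ lam b y, 0 ≤ g' lam b y) ∧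
      (∀ b y, 0 ≤ h' b y) ∧
      (∀ b lam x y, ∑ a, f' a b lam x y = 1) ∧
      (∀ b y, ∑ lam, g' lam b y = 1) ∧
      (∀ y, ∑ b, h' b y = 1) ∧
      (∀ a b lam x y, p a b lam x y = f' a b lam x y * g' lam b y * h' b y)) :
    -- (i) measurement independence
    (∀ lam x y x' y', ∑ a, ∑ b, p a b lam x y = ∑ a, ∑ b, p a b lam x' y') ∧
    -- (ii) parameter independence for the preparation
    (∀ a lam x y y', ∑ b, p a b lam x y = ∑ b, p a b lam x y') ∧
    -- (iii) parameter independence for the measurement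
    (∀ b lam y x x', ∑ a, p a b lam x y = ∑ a, p a b lam x' y) := by
  obtain ⟨f, g, h, -, -, -, hf, -, -, hp⟩ := hNR
  obtain ⟨f', g', h', -, -, -, hf', -, -, hp'⟩ := hTS
  have h1 : ∀ a lam x y, ∑ b, p a b lam x y = g lam a x * h a x := by
    intro a lam x y
    simp only [hp, mul_assoc]
    rw [← Finset.sum_mul, hf, one_mul]
  have h2 : ∀ b lam x y, ∑ a, p a b lam x y = g' lam b y * h' b y := by
    intro b lam x y
    simp only [hp', mul_assoc]
    rw [← Finset.sum_mul, hf', one_mul]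
  refine ⟨?_, ?_, ?_⟩
  · intro lam x y x' y'
    calc ∑ a, ∑ b, p a b lam x y = ∑ a, ∑ b, p a b lam x y' := by simp only [h1]
      _ = ∑ b, ∑ a, p a b lam x y' := Finset.sum_comm
      _ = ∑ b, ∑ a, p a b lam x' y' := by simp only [h2]
      _ = ∑ a, ∑ b, p a b lam x' y' := Finset.sum_comm
  · intro a lam x y y'
    rw [h1, h1]
  · intro b lam y x x'
    rw [h2, h2]
end

section
/- Main Theorem (Theorem 2): Let p be an ontic extension satisfying No Retrocausality, Time Symmetry (time-reversed No Retrocausality), and λ-mediation. Then p satisfies Bell's local causality condition: there exist nonnegative functions q(λ) with ∑_λ q(λ) = 1, α(a|x,λ) with ∑_a α(a|x,λ) = 1 whenever q(λ) > 0, and β(b|y,λ) with ∑_b β(b|y,λ) = 1 whenever q(λ) > 0, such that p(a,b,λ|x,y) = α(a|x,λ)·β(b|y,λ)·q(λ) for all a,b,λ,x,y. -/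
/-- **Main Theorem (Theorem 2).** An ontic extension satisfying No Retrocausality,
Time Symmetry (time-reversed No Retrocausality), and λ-mediation obeys Bell's local
causality condition. -/
theorem main_theorem
    (X Y A B Λ : Type) [Fintype X] [Fintype Y] [Fintype A] [Fintype B] [Fintype Λ]
    [Nonempty X] [Nonempty Y] [Nonempty A] [Nonempty B]
    (p : A → B → Λ → X → Y → ℝ)
    (hp_nonneg : ∀ a b lam x y, 0 ≤ p a b lam x y)
    (hp_norm : ∀ x y, ∑ a, ∑ b, ∑ lam, p a b lam x y = 1)
    -- No Retrocausality
    (hNR : ∃ (f : B → A → Λ → X → Y → ℝ) (g : Λ → A → X → ℝ) (h : A → X → ℝ),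
      (∀ b a lam x y, 0 ≤ f b a lam x y) ∧ (∀ lam a x, 0 ≤ g lam a x) ∧
      (∀ a x, 0 ≤ h a x) ∧
      (∀ a lam x y, ∑ b, f b a lam x y = 1) ∧
      (∀ a x, ∑ lam, g lam a x = 1) ∧
      (∀ x, ∑ a, h a x = 1) ∧
      (∀ a b lam x y, p a b lam x y = f b a lam x y * g lam a x * h a x))
    -- Time Symmetry (time-reversed No Retrocausality)
    (hTS : ∃ (f' : A → B → Λ → X → Y → ℝ) (g' : Λ → B → Y → ℝ) (h' : B → Y → ℝ),
      (∀ a b lam x y, 0 ≤ f' a b lam x y) ∧ (∀ lam b y, 0 ≤ g' lam b y) ∧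
      (∀ b y, 0 ≤ h' b y) ∧
      (∀ b lam x y, ∑ a, f' a b lam x y = 1) ∧
      (∀ b y, ∑ lam, g' lam b y = 1) ∧
      (∀ y, ∑ b, h' b y = 1) ∧
      (∀ a b lam x y, p a b lam x y = f' a b lam x y * g' lam b y * h' b y))
    -- λ-mediation: the response-function factor of the No Retrocausality decomposition
    -- can be chosen to depend only on (b, λ, y)
    (hMed : ∃ (r : B → Λ → Y → ℝ) (g : Λ → A → X → ℝ) (h : A → X → ℝ),
      (∀ b lam y, 0 ≤ r b lam y) ∧ (∀ lam a x, 0 ≤ g lam a x) ∧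
      (∀ a x, 0 ≤ h a x) ∧
      (∀ lam y, ∑ b, r b lam y = 1) ∧
      (∀ a x, ∑ lam, g lam a x = 1) ∧
      (∀ x, ∑ a, h a x = 1) ∧
      (∀ a b lam x y, p a b lam x y = r b lam y * g lam a x * h a x)) :
    -- Bell's local causality condition
    ∃ (q : Λ → ℝ) (α : A → X → Λ → ℝ) (β : B → Y → Λ → ℝ),
      (∀ lam, 0 ≤ q lam) ∧ (∀ a x lam, 0 ≤ α a x lam) ∧ (∀ b y lam, 0 ≤ β b y lam) ∧
      (∑ lam, q lam = 1) ∧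
      (∀ x lam, 0 < q lam → ∑ a, α a x lam = 1) ∧
      (∀ y lam, 0 < q lam → ∑ b, β b y lam = 1) ∧
      (∀ a b lam x y, p a b lam x y = α a x lam * β b y lam * q lam) := by
  obtain ⟨f', g', h', -, -, -, hf', -, -, hp'⟩ := hTS
  obtain ⟨r, g, h, hr0, hg0, hh0, hr, hg, hh, hp⟩ := hMed
  have key : ∀ lam x y, ∑ a, g lam a x * h a x = ∑ b, g' lam b y * h' b y := by
    intro lam x y
    have h1 : ∑ a, ∑ b, p a b lam x y = ∑ a, g lam a x * h a x := by
      refine Finset.sum_congr rfl fun a _ => ?_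
      simp only [hp, mul_assoc]
      rw [← Finset.sum_mul, hr, one_mul]
    have h2 : ∑ b, ∑ a, p a b lam x y = ∑ b, g' lam b y * h' b y := by
      refine Finset.sum_congr rfl fun b _ => ?_
      simp only [hp', mul_assoc]
      rw [← Finset.sum_mul, hf', one_mul]
    rw [← h1, ← h2, Finset.sum_comm]
  obtain ⟨x0⟩ := ‹Nonempty X›
  obtain ⟨y0⟩ := ‹Nonempty Y›
  have hQ : ∀ lam x, ∑ a, g lam a x * h a x = ∑ a, g lam a x0 * h a x0 :=
    fun lam x => (key lam x y0).trans (key lam x0 y0).symm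
  have hq0 : ∀ lam, 0 ≤ ∑ a, g lam a x0 * h a x0 := fun lam =>
    Finset.sum_nonneg fun a _ => mul_nonneg (hg0 _ _ _) (hh0 _ _)
  refine ⟨fun lam => ∑ a, g lam a x0 * h a x0,
    fun a x lam => g lam a x * h a x / ∑ a, g lam a x0 * h a x0,
    fun b y lam => r b lam y, hq0, ?_, fun b y lam => hr0 _ _ _, ?_, ?_,
    fun y lam _ => hr lam y, ?_⟩
  · intro a x lam
    exact div_nonneg (mul_nonneg (hg0 _ _ _) (hh0 _ _)) (hq0 lam)
  · rw [Finset.sum_comm]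
    simp only [← Finset.sum_mul, hg, one_mul, hh]
  · intro x lam hq
    rw [← Finset.sum_div, hQ]
    exact div_self hq.ne'
  · intro a b lam x y
    rw [hp]
    by_cases hq : ∑ a, g lam a x0 * h a x0 = 0
    · have hz := hQ lam x
      rw [hq, Finset.sum_eq_zero_iff_of_nonneg
        (fun a _ => mul_nonneg (hg0 _ _ _) (hh0 _ _))] at hz
      have := hz a (Finset.mem_univ a)
      beta_reduce
      rw [mul_assoc, this, hq]
      simp
    · beta_reduce
      field_simp
end

section
/- Jarrett decomposition step (proved in the proof of Theorem 2): Let p be an ontic extension satisfying No Retrocausality, and suppose additionally: (measurement independence) the marginal ∑_{a,b} p(a,b,λ|x,y) takes the same value q(λ) for all (x,y); (parameter independence) ∑_b p(a,b,λ|x,y) is independent of y and ∑_a p(a,b,λ|x,y) is independent of x; and (outcome independence/λ-mediation) the function f in the No Retrocausality decomposition depends only on (b,λ,y). Then Bell's local causality condition holds: there exist nonnegative α(a|x,λ) and β(b|y,λ), each summing to 1 over its output whenever q(λ) > 0, such that p(a,b,λ|x,y) = α(a|x,λ)·β(b|y,λ)·q(λ) for all a,b,λ,x,y. -/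
/-- **Jarrett decomposition step** (from the proof of Theorem 2): No Retrocausality
together with measurement independence, parameter independence, and outcome
independence (λ-mediation) implies Bell's local causality condition. -/
theorem jarrett_decomposition
    (X Y A B Λ : Type) [Fintype X] [Fintype Y] [Fintype A] [Fintype B] [Fintype Λ]
    [Nonempty X] [Nonempty Y] [Nonempty A] [Nonempty B]
    (p : A → B → Λ → X → Y → ℝ)
    (hp_nonneg : ∀ a b lam x y, 0 ≤ p a b lam x y)
    (hp_norm : ∀ x y, ∑ a, ∑ b, ∑ lam, p a b lam x y = 1)
    (q : Λ → ℝ)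
    -- No Retrocausality with outcome independence / λ-mediation: the factor `f`
    -- of the decomposition depends only on (b, λ, y)
    (hNR : ∃ (f : B → Λ → Y → ℝ) (g : Λ → A → X → ℝ) (h : A → X → ℝ),
      (∀ b lam y, 0 ≤ f b lam y) ∧ (∀ lam a x, 0 ≤ g lam a x) ∧
      (∀ a x, 0 ≤ h a x) ∧
      (∀ lam y, ∑ b, f b lam y = 1) ∧
      (∀ a x, ∑ lam, g lam a x = 1) ∧
      (∀ x, ∑ a, h a x = 1) ∧
      (∀ a b lam x y, p a b lam x y = f b lam y * g lam a x * h a x))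
    -- measurement independence
    (hMI : ∀ lam x y, ∑ a, ∑ b, p a b lam x y = q lam)
    -- parameter independence
    (hPI1 : ∀ a lam x y y', ∑ b, p a b lam x y = ∑ b, p a b lam x y')
    (hPI2 : ∀ b lam y x x', ∑ a, p a b lam x y = ∑ a, p a b lam x' y) :
    -- Bell's local causality condition
    ∃ (α : A → X → Λ → ℝ) (β : B → Y → Λ → ℝ),
      (∀ a x lam, 0 ≤ α a x lam) ∧ (∀ b y lam, 0 ≤ β b y lam) ∧
      (∀ x lam, 0 < q lam → ∑ a, α a x lam = 1) ∧
      (∀ y lam, 0 < q lam → ∑ b, β b y lam = 1) ∧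
      (∀ a b lam x y, p a b lam x y = α a x lam * β b y lam * q lam) := by
  obtain ⟨f, g, h, hf, hg, hh, hfs, hgs, hhs, hp⟩ := hNR
  have hq : ∀ lam x, ∑ a, g lam a x * h a x = q lam := by
    intro lam x
    obtain ⟨y⟩ := (inferInstance : Nonempty Y)
    rw [← hMI lam x y]
    refine Finset.sum_congr rfl fun a _ => ?_
    simp only [hp, mul_assoc]
    rw [← Finset.sum_mul, hfs, one_mul]
  have hgh : ∀ lam a x, 0 ≤ g lam a x * h a x := fun lam a x => mul_nonneg (hg _ _ _) (hh _ _)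
  have hq0 : ∀ lam, 0 ≤ q lam := by
    intro lam
    obtain ⟨x⟩ := (inferInstance : Nonempty X)
    rw [← hq lam x]
    exact Finset.sum_nonneg fun a _ => hgh lam a x
  refine ⟨fun a x lam => g lam a x * h a x / q lam, fun b y lam => f b lam y,
    fun a x lam => div_nonneg (hgh _ _ _) (hq0 _), fun b y lam => hf _ _ _, ?_,
    fun y lam _ => hfs lam y, ?_⟩
  · intro x lam hpos
    rw [← Finset.sum_div, hq, div_self hpos.ne']
  · intro a b lam x y
    rw [hp]
    by_cases h0 : q lam = 0
    · have h1 := hq lam x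
      rw [h0, Finset.sum_eq_zero_iff_of_nonneg (fun a _ => hgh lam a x)] at h1
      rw [mul_assoc, h1 a (Finset.mem_univ a), h0]
      simp
    · field_simp
end

section
/- Quantum violation of the timelike CHSH inequality (Section VII B): For θ ∈ ℝ let P(θ) denote the 2×2 real projector [[cos²(θ/2), sin(θ/2)cos(θ/2)],[sin(θ/2)cos(θ/2), sin²(θ/2)]]. Define ρ_{0|0} = ½P(0), ρ_{1|0} = ½P(π), ρ_{0|1} = ½P(π/2), ρ_{1|1} = ½P(−π/2), E_{0|0} = P(π/4), E_{1|0} = P(−3π/4), E_{0|1} = P(−π/4), E_{1|1} = P(3π/4), and p(a,b|x,y) := Tr(E_{b|y}·ρ_{a|x}) for a,b,x,y ∈ {0,1}. Then: (i) the preparation is no-signalling, i.e. ρ_{0|0} + ρ_{1|0} = ρ_{0|1} + ρ_{1|1} = ½I; and (ii) the CHSH expression equals (2+√2)/4, i.e. (1/4)·∑_{x,y∈{0,1}} ∑_{a,b∈{0,1}, a⊕b=x·y} p(a,b|x,y) = (2+√2)/4, which is strictly greater than 3/4 (⊕ denotes addition modulo 2). -/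
open Matrix
open scoped ComplexOrder

/-- The 2×2 projector onto the real direction at angle `θ` on the Bloch circle. -/
noncomputable def chshProj (θ : ℝ) : Matrix (Fin 2) (Fin 2) ℂ :=
  !![((Real.cos (θ/2) : ℂ))^2, (Real.sin (θ/2) : ℂ) * (Real.cos (θ/2) : ℂ);
     (Real.sin (θ/2) : ℂ) * (Real.cos (θ/2) : ℂ), ((Real.sin (θ/2) : ℂ))^2]

/-- The preparation states of the timelike CHSH experiment. -/
noncomputable def chshState (a x : ZMod 2) : Matrix (Fin 2) (Fin 2) ℂ :=
  if x = 0 then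
    (if a = 0 then (1/2 : ℂ) • chshProj 0 else (1/2 : ℂ) • chshProj Real.pi)
  else
    (if a = 0 then (1/2 : ℂ) • chshProj (Real.pi/2) else (1/2 : ℂ) • chshProj (-(Real.pi/2)))

/-- The measurement POVM elements of the timelike CHSH experiment. -/
noncomputable def chshEffect (b y : ZMod 2) : Matrix (Fin 2) (Fin 2) ℂ :=
  if y = 0 then
    (if b = 0 then chshProj (Real.pi/4) else chshProj (-(3*Real.pi/4)))
  else
    (if b = 0 then chshProj (-(Real.pi/4)) else chshProj (3*Real.pi/4))

/-- Double-angle form of the projector. -/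
theorem chshProj_eq (θ : ℝ) : chshProj θ =
    !![(((1 + Real.cos θ)/2 : ℝ) : ℂ), ((Real.sin θ/2 : ℝ) : ℂ);
       ((Real.sin θ/2 : ℝ) : ℂ), (((1 - Real.cos θ)/2 : ℝ) : ℂ)] := by
  have hc : Real.cos θ = 2 * Real.cos (θ/2)^2 - 1 := by
    rw [← Real.cos_two_mul]; congr 1; ring
  have hs : Real.sin θ = 2 * Real.sin (θ/2) * Real.cos (θ/2) := by
    rw [← Real.sin_two_mul]; congr 1; ring
  have h1 := Real.sin_sq_add_cos_sq (θ/2)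
  have e1 : (1 + Real.cos θ)/2 = Real.cos (θ/2)^2 := by rw [hc]; ring
  have e2 : Real.sin θ/2 = Real.sin (θ/2) * Real.cos (θ/2) := by rw [hs]; ring
  have e3 : (1 - Real.cos θ)/2 = Real.sin (θ/2)^2 := by rw [hc]; linarith
  rw [e1, e2, e3, chshProj]
  push_cast
  rfl

theorem chshProj_trace (α β : ℝ) :
    (chshProj α * ((1/2 : ℂ) • chshProj β)).trace = (((1 + Real.cos (α - β))/4 : ℝ) : ℂ) := by
  rw [chshProj_eq, chshProj_eq, Real.cos_sub]
  simp [Matrix.trace_fin_two, Matrix.mul_apply, Fin.sum_univ_two]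
  ring

theorem chsh_sum (f : ZMod 2 → ℂ) : ∑ x : ZMod 2, f x = f 0 + f 1 :=
  Fin.sum_univ_two f

/-- **Quantum violation of the timelike CHSH inequality** (Section VII B): the
preparation is no-signalling, and the CHSH expression equals `(2+√2)/4 > 3/4`. -/
theorem timelike_CHSH_violation :
    -- (i) no-signalling
    (chshState 0 0 + chshState 1 0 = (1/2 : ℂ) • (1 : Matrix (Fin 2) (Fin 2) ℂ) ∧
     chshState 0 1 + chshState 1 1 = (1/2 : ℂ) • (1 : Matrix (Fin 2) (Fin 2) ℂ)) ∧
    -- (ii) the CHSH expression equals (2+√2)/4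
    ((1/4 : ℂ) * ∑ x : ZMod 2, ∑ y : ZMod 2, ∑ a : ZMod 2, ∑ b : ZMod 2,
        (if a + b = x * y then (chshEffect b y * chshState a x).trace else 0)
      = (((2 + Real.sqrt 2) / 4 : ℝ) : ℂ)) ∧
    -- which is strictly greater than 3/4
    ((3/4 : ℝ) < (2 + Real.sqrt 2) / 4) := by
  have h10 : (1 : ZMod 2) ≠ 0 := by decide
  have h11 : (1 : ZMod 2) + 1 = 0 := by decide
  refine ⟨⟨?_, ?_⟩, ?_, ?_⟩
  · simp only [chshState, if_true, if_neg h10, chshProj_eq]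
    ext i j
    fin_cases i <;> fin_cases j <;> simp
  · simp only [chshState, if_true, if_neg h10, chshProj_eq]
    ext i j
    fin_cases i <;> fin_cases j <;> simp <;> norm_num
  · have k : ∀ α : ℝ, Real.cos α = √2/2 → (((1 + Real.cos α)/4 : ℝ) : ℂ) =
        (((1 + √2/2)/4 : ℝ) : ℂ) := by
      intro α h; rw [h]
    have c0 := Real.cos_pi_div_four
    have c1 : Real.cos (Real.pi/4 - 0) = √2/2 := by rw [← c0]; congr 1; ring
    have c2 : Real.cos (-(3*Real.pi/4) - Real.pi) = √2/2 := by
      rw [← c0, ← Real.cos_add_two_pi]; congr 1; ring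
    have c3 : Real.cos (-(Real.pi/4) - 0) = √2/2 := by
      rw [← c0, ← Real.cos_neg]; congr 1; ring
    have c4 : Real.cos (3*Real.pi/4 - Real.pi) = √2/2 := by
      rw [← c0, ← Real.cos_neg]; congr 1; ring
    have c5 : Real.cos (Real.pi/4 - Real.pi/2) = √2/2 := by
      rw [← c0, ← Real.cos_neg]; congr 1; ring
    have c6 : Real.cos (-(3*Real.pi/4) - -(Real.pi/2)) = √2/2 := by
      rw [← c0, ← Real.cos_neg]; congr 1; ring
    have c7 : Real.cos (3*Real.pi/4 - Real.pi/2) = √2/2 := by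
      rw [← c0]; congr 1; ring
    have c8 : Real.cos (-(Real.pi/4) - -(Real.pi/2)) = √2/2 := by
      rw [← c0]; congr 1; ring
    simp only [chsh_sum, chshState, chshEffect, if_true, if_neg h10, if_neg h10.symm, h11,
      add_zero, zero_add, mul_zero, zero_mul, mul_one, chshProj_trace,
      c1, c2, c3, c4, c5, c6, c7, c8]
    push_cast
    ring
  · have : (1 : ℝ) < √2 := by
      rw [Real.lt_sqrt] <;> norm_num
    linarith
end

section
/- No locally causal model for the timelike CHSH experiment (the incompatibility asserted in Section VII B): Let p(a,b|x,y) := Tr(E_{b|y}·ρ_{a|x}) for a,b,x,y ∈ {0,1}, with ρ_{0|0} = ½P(0), ρ_{1|0} = ½P(π), ρ_{0|1} = ½P(π/2), ρ_{1|1} = ½P(−π/2), E_{0|0} = P(π/4), E_{1|0} = P(−3π/4), E_{0|1} = P(−π/4), E_{1|1} = P(3π/4), where P(θ) is the 2×2 projector [[cos²(θ/2), sin(θ/2)cos(θ/2)],[sin(θ/2)cos(θ/2), sin²(θ/2)]]. Then there exist no finite set Λ, nonnegative weights q(λ) with ∑_λ q(λ) = 1, and nonnegative functions α(a|x,λ)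 with ∑_a α(a|x,λ) = 1 and β(b|y,λ) with ∑_b β(b|y,λ) = 1, such that p(a,b|x,y) = ∑_λ q(λ)·α(a|x,λ)·β(b|y,λ) for all a,b,x,y. In particular, this experiment has no ontic extension satisfying No Retrocausality, λ-mediation, and Time Symmetry. -/
open Matrix
open scoped ComplexOrder

theorem chsh_trace (θ φ : ℝ) :
    (chshProj θ * ((1/2 : ℂ) • chshProj φ)).trace = (((1 + Real.cos (θ - φ)) / 4 : ℝ) : ℂ) := by
  have h : Real.cos (θ - φ) = 2 * (Real.cos (θ/2) * Real.cos (φ/2)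
      + Real.sin (θ/2) * Real.sin (φ/2))^2 - 1 := by
    rw [← Real.cos_sub, ← Real.cos_two_mul]
    congr 1
    ring
  rw [h]
  simp only [chshProj, Matrix.trace, Matrix.diag, Matrix.mul_apply, Fin.sum_univ_two,
    Matrix.smul_apply, Matrix.of_apply, Matrix.cons_val', Matrix.cons_val_zero,
    Matrix.cons_val_one, Matrix.cons_val_fin_one, smul_eq_mul]
  push_cast
  ring

theorem chsh_point (a a' b b' : ℝ) (h1 : 0 ≤ a) (h2 : a ≤ 1) (h3 : 0 ≤ a') (h4 : a' ≤ 1)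
    (h5 : 0 ≤ b) (h6 : b ≤ 1) (h7 : 0 ≤ b') (h8 : b' ≤ 1) :
    a * b' + a' * b - a' * b' - a * (1 - b) - (1 - a) * b - a * b ≤ 0 := by
  rcases le_total a a' with h | h
  · nlinarith [mul_nonneg (sub_nonneg.2 h) h7, mul_nonneg h1 (sub_nonneg.2 h6),
      mul_nonneg (sub_nonneg.2 h4) h5]
  · nlinarith [mul_nonneg (sub_nonneg.2 h) (sub_nonneg.2 h8), mul_nonneg h3 (sub_nonneg.2 h6),
      mul_nonneg (sub_nonneg.2 h2) h5, mul_nonneg h1 (sub_nonneg.2 h6),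
      mul_nonneg (sub_nonneg.2 h4) h5]

theorem chsh_cos34 : Real.cos (3 * Real.pi / 4) = -(√2 / 2) := by
  rw [show 3 * Real.pi / 4 = Real.pi - Real.pi / 4 by ring, Real.cos_pi_sub, Real.cos_pi_div_four]

/-- **No locally causal model for the timelike CHSH experiment** (Section VII B):
the probabilities `p(a,b|x,y) := Tr(E_{b|y} ρ_{a|x})` admit no factorizable
(locally causal) model; in particular, this experiment has no ontic extension
satisfying No Retrocausality, λ-mediation, and Time Symmetry. -/
theorem timelike_CHSH_no_local_causal_model :
    ¬ ∃ (Λ : Type) (_ : Fintype Λ) (q : Λ → ℝ)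
        (α : ZMod 2 → ZMod 2 → Λ → ℝ) (β : ZMod 2 → ZMod 2 → Λ → ℝ),
      (∀ lam, 0 ≤ q lam) ∧ (∑ lam, q lam = 1) ∧
      (∀ a x lam, 0 ≤ α a x lam) ∧ (∀ x lam, ∑ a, α a x lam = 1) ∧
      (∀ b y lam, 0 ≤ β b y lam) ∧ (∀ y lam, ∑ b, β b y lam = 1) ∧
      (∀ a b x y : ZMod 2,
        (chshEffect b y * chshState a x).trace
          = ((∑ lam, q lam * α a x lam * β b y lam : ℝ) : ℂ)) := by
  rintro ⟨Λ, _, q, α, β, hq, hq1, ha, ha1, hb, hb1, hp⟩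
  have h10 : (1 : ZMod 2) ≠ 0 := by decide
  have c4 := Real.cos_pi_div_four
  have c34 := chsh_cos34
  have sa : ∀ x l, α 0 x l + α 1 x l = 1 := fun x l => by
    have := ha1 x l
    rwa [show (∑ a, α a x l) = α 0 x l + α 1 x l from Fin.sum_univ_two _] at this
  have sb : ∀ x l, β 0 x l + β 1 x l = 1 := fun x l => by
    have := hb1 x l
    rwa [show (∑ a, β a x l) = β 0 x l + β 1 x l from Fin.sum_univ_two _] at this
  have e00 := hp 0 0 0 0
  have e01 := hp 0 0 0 1
  have e10 := hp 0 0 1 0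
  have e11 := hp 0 0 1 1
  have f01 := hp 0 1 0 0
  have f10 := hp 1 0 0 0
  simp only [chshEffect, chshState, h10, if_true, if_false, chsh_trace, Complex.ofReal_inj]
    at e00 e01 e10 e11 f01 f10
  rw [show Real.pi / 4 - 0 = Real.pi / 4 by ring, c4] at e00
  rw [show -(Real.pi / 4) - 0 = -(Real.pi / 4) by ring, Real.cos_neg, c4] at e01
  rw [show Real.pi / 4 - Real.pi / 2 = -(Real.pi / 4) by ring, Real.cos_neg, c4] at e10
  rw [show -(Real.pi / 4) - Real.pi / 2 = -(3 * Real.pi / 4) by ring, Real.cos_neg, c34] at e11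
  rw [show -(3 * Real.pi / 4) - 0 = -(3 * Real.pi / 4) by ring, Real.cos_neg, c34] at f01
  rw [show Real.pi / 4 - Real.pi = -(3 * Real.pi / 4) by ring, Real.cos_neg, c34] at f10
  have key : ∑ l, (q l * α 0 0 l * β 0 1 l + q l * α 0 1 l * β 0 0 l - q l * α 0 1 l * β 0 1 l
      - q l * α 0 0 l * β 1 0 l - q l * α 1 0 l * β 0 0 l - q l * α 0 0 l * β 0 0 l) ≤ 0 := by
    apply Finset.sum_nonpos
    intro l _
    have hpt := chsh_point (α 0 0 l) (α 0 1 l) (β 0 0 l) (β 0 1 l) (ha _ _ _)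
      (by linarith [sa 0 l, ha 1 0 l]) (ha _ _ _) (by linarith [sa 1 l, ha 1 1 l]) (hb _ _ _)
      (by linarith [sb 0 l, hb 1 0 l]) (hb _ _ _) (by linarith [sb 1 l, hb 1 1 l])
    rw [show β 1 0 l = 1 - β 0 0 l by linarith [sb 0 l],
      show α 1 0 l = 1 - α 0 0 l by linarith [sa 0 l]]
    have := mul_nonpos_of_nonneg_of_nonpos (hq l) hpt
    linarith
  simp only [Finset.sum_sub_distrib, Finset.sum_add_distrib] at key
  rw [← e00, ← e01, ← e10, ← e11, ← f01, ← f10] at key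
  have : (1 : ℝ) < √2 := by
    rw [Real.lt_sqrt] <;> norm_num
  linarith
end

section
/- Parameter independence without λ-mediation (Appendix, Eqs. (A1)–(A3)): Let p be an ontic extension satisfying No Retrocausality and Time Symmetry (time-reversed No Retrocausality), and let q(λ) := ∑_{a,b} p(a,b,λ|x,y) (which by Lemma 1 is independent of (x,y)). Then for every λ with q(λ) > 0, the conditional distributions satisfy parameter independence: the quantity (∑_b p(a,b,λ|x,y))/q(λ) is independent of y for all a,x, and the quantity (∑_a p(a,b,λ|x,y))/q(λ) is independent of x for all b,y. -/
/-- **Parameter independence without λ-mediation** (Appendix, Eqs. (A1)–(A3)):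
if an ontic extension satisfies No Retrocausality and Time Symmetry, then with
`q(λ) := ∑_{a,b} p(a,b,λ|x,y)` (independent of the choice of `(x,y)` by Lemma 1),
the conditional distributions satisfy parameter independence wherever `q(λ) > 0`. -/
theorem parameter_independence_without_lambda_mediation
    (X Y A B Λ : Type) [Fintype X] [Fintype Y] [Fintype A] [Fintype B] [Fintype Λ]
    [Inhabited X] [Inhabited Y] [Nonempty A] [Nonempty B]
    (p : A → B → Λ → X → Y → ℝ)
    (hp_nonneg : ∀ a b lam x y, 0 ≤ p a b lam x y)
    (hp_norm : ∀ x y, ∑ a, ∑ b, ∑ lam, p a b lam x y = 1)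
    -- No Retrocausality
    (hNR : ∃ (f : B → A → Λ → X → Y → ℝ) (g : Λ → A → X → ℝ) (h : A → X → ℝ),
      (∀ b a lam x y, 0 ≤ f b a lam x y) ∧ (∀ lam a x, 0 ≤ g lam a x) ∧
      (∀ a x, 0 ≤ h a x) ∧
      (∀ a lam x y, ∑ b, f b a lam x y = 1) ∧
      (∀ a x, ∑ lam, g lam a x = 1) ∧
      (∀ x, ∑ a, h a x = 1) ∧
      (∀ a b lam x y, p a b lam x y = f b a lam x y * g lam a x * h a x))
    -- Time Symmetry (time-reversed No Retrocausality)
    (hTS : ∃ (f' : A → B → Λ → X → Y → ℝ) (g' : Λ → B → Y → ℝ) (h' : B → Y → ℝ),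
      (∀ a b lam x y, 0 ≤ f' a b lam x y) ∧ (∀ lam b y, 0 ≤ g' lam b y) ∧
      (∀ b y, 0 ≤ h' b y) ∧
      (∀ b lam x y, ∑ a, f' a b lam x y = 1) ∧
      (∀ b y, ∑ lam, g' lam b y = 1) ∧
      (∀ y, ∑ b, h' b y = 1) ∧
      (∀ a b lam x y, p a b lam x y = f' a b lam x y * g' lam b y * h' b y))
    -- q(λ), independent of (x,y) by Lemma 1
    (q : Λ → ℝ)
    (hq : ∀ lam x y, ∑ a, ∑ b, p a b lam x y = q lam) :
    ∀ lam, 0 < q lam →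
      ((∀ a x y y',
          (∑ b, p a b lam x y) / q lam = (∑ b, p a b lam x y') / q lam) ∧
       (∀ b y x x',
          (∑ a, p a b lam x y) / q lam = (∑ a, p a b lam x' y) / q lam)) := by
  obtain ⟨f, g, h, -, -, -, hf, -, -, hfp⟩ := hNR
  obtain ⟨f', g', h', -, -, -, hf', -, -, hfp'⟩ := hTS
  have h1 : ∀ lam a x y, ∑ b, p a b lam x y = g lam a x * h a x := by
    intro lam a x y
    simp only [hfp, mul_assoc]
    rw [← Finset.sum_mul, hf, one_mul]
  have h2 : ∀ lam b x y, ∑ a, p a b lam x y = g' lam b y * h' b y := by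
    intro lam b x y
    simp only [hfp', mul_assoc]
    rw [← Finset.sum_mul, hf', one_mul]
  intro lam _
  refine ⟨fun a x y y' => ?_, fun b y x x' => ?_⟩
  · rw [h1, h1]
  · rw [h2, h2]
end
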